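/- Let R be a Noetherian integral domain, let C be a bounded cochain complex of finitely generated free R-modules, and let p be a prime ideal of R with residue field κ(p). Assume: (a) H^i(C ⊗_R κ(p)) = 0 for all i ≥ 2; and (b) there is a dense open subset U of Spec R such that for every q ∈ U, dim_{κ(q)} H^1(C ⊗_R κ(q)) = dim_{κ(p)} H^1(C ⊗_R κ(p)). Then the natural base-change map H^0(C) ⊗_R κ(p) → H^0(C ⊗_R κ(p)), sending [z] ⊗ λ to [z ⊗ λ], is an isomorphism of κ(p)-vector spaces. -/

import Mathlib

open scoped TensorProduct

/-- The (co)homology-style subquotient `Z / (Z ∩ B)` of a pair of submodules `Z, B` of an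
ambient module: the quotient of `Z` by the preimage of `B` under the inclusion `Z ↪ V`.
When `B ≤ Z` (e.g. cocycles and coboundaries of a complex) this is the usual quotient `Z/B`. -/
abbrev subquot {F V : Type*} [Ring F] [AddCommGroup V] [Module F V]
    (Z B : Submodule F V) : Type _ :=
  ↥Z ⧸ Submodule.comap Z.subtype B

/-- `H^1` of the base change of the complex `(C, d)` to an `R`-algebra field `F`:
`ker (d 1 ⊗ F) / im (d 0 ⊗ F)`. -/
noncomputable abbrev H1BaseChange {R : Type*} [CommRing R] {C : ℤ → Type*}
    [∀ i, AddCommGroup (C i)] [∀ i, Module R (C i)]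
    (d : ∀ i : ℤ, C i →ₗ[R] C (i + 1)) (F : Type*) [Field F] [Algebra R F] : Type _ :=
  subquot (LinearMap.ker (LinearMap.baseChange F (d 1)))
    (LinearMap.range (LinearMap.baseChange F (d 0)))

namespace Matrix

lemma exists_linearIndependent_rows {F m n : Type*} [Field F] [Fintype m] [Fintype n]
    (A : Matrix m n F) : ∃ e : Fin A.rank → m, LinearIndependent F fun k ↦ A (e k) := by
  obtain ⟨κ, a, ha, hspan, hli⟩ := exists_linearIndependent' F A.row
  have : Finite κ := Finite.of_injective a ha
  have := Fintype.ofFinite κ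
  have hcard : Fintype.card κ = A.rank := by
    rw [rank_eq_finrank_span_row, ← hspan, finrank_span_eq_card hli]
  let u := (Fintype.equivFinOfCardEq hcard).symm
  exact ⟨a ∘ u, hli.comp u u.injective⟩

lemma exists_submatrix_rank_det_ne_zero {F m n : Type*} [Field F] [Fintype m] [Fintype n]
    (A : Matrix m n F) :
    ∃ (e : Fin A.rank → m) (g : Fin A.rank → n), (A.submatrix e g).det ≠ 0 := by
  obtain ⟨e, he⟩ := A.exists_linearIndependent_rows
  have hr : (A.submatrix e id)ᵀ.rank = A.rank := by
    rw [rank_transpose, LinearIndependent.rank_matrix (M := A.submatrix e id) he, Fintype.card_fin]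
  obtain ⟨g, hg⟩ := (A.submatrix e id)ᵀ.exists_linearIndependent_rows
  refine ⟨e, g ∘ finCongr hr.symm, ?_⟩
  have h := hg.comp _ (finCongr hr.symm).injective
  rw [← det_transpose]
  exact ((isUnit_iff_isUnit_det _).1 (linearIndependent_rows_iff_isUnit.1 h)).ne_zero

lemma exists_eq_submatrix_mul {F m n r : Type*} [Field F] [Fintype m] [Fintype n] [Fintype r]
    (A : Matrix m n F) (g : r → n) (h : A.rank ≤ (A.submatrix id g).rank) :
    ∃ Y : Matrix r n F, A = A.submatrix id g * Y := by
  have hle : LinearMap.range (A.submatrix id g).mulVecLin ≤ LinearMap.range A.mulVecLin := by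
    classical
    rw [range_mulVecLin, range_mulVecLin]
    apply Submodule.span_mono
    rintro _ ⟨k, rfl⟩
    exact ⟨g k, rfl⟩
  have heq := Submodule.eq_of_le_of_finrank_le hle h
  have hcol : ∀ j, ∃ y : r → F, (A.submatrix id g) *ᵥ y = A.col j := by
    intro j
    have : A.col j ∈ LinearMap.range (A.submatrix id g).mulVecLin := by
      rw [heq, range_mulVecLin]
      exact Submodule.subset_span ⟨j, rfl⟩
    exact this
  choose y hy using hcol
  refine ⟨of fun k j ↦ y j k, ?_⟩
  ext i j
  exact (congrFun (hy j) i).symm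

section BaseChange

variable {R K κ m n : Type*} [CommRing R] [Field K] [Algebra R K] [FaithfulSMul R K]
  [Field κ] [Algebra R κ] [Fintype m] [Fintype n]

omit [Field K] [Algebra R K] [FaithfulSMul R K] in
lemma exists_algebraMap_det_submatrix_ne_zero (A : Matrix m n R) {r : ℕ}
    (hr : (A.map (algebraMap R κ)).rank = r) :
    ∃ (e : Fin r → m) (g : Fin r → n), algebraMap R κ (A.submatrix e g).det ≠ 0 := by
  subst hr
  obtain ⟨e, g, hdet⟩ := (A.map (algebraMap R κ)).exists_submatrix_rank_det_ne_zero
  refine ⟨e, g, ?_⟩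
  rw [RingHom.map_det]
  exact hdet

lemma det_map_algebraMap_ne_zero_of_algebraMap_det_ne_zero {r : ℕ} {P : Matrix (Fin r) (Fin r) R}
    (hP : algebraMap R κ P.det ≠ 0) : (P.map (algebraMap R K)).det ≠ 0 := by
  have : P.det ≠ 0 := fun h ↦ hP (by rw [h, map_zero])
  rw [← RingHom.mapMatrix_apply, ← RingHom.map_det]
  exact (map_ne_zero_iff _ (FaithfulSMul.algebraMap_injective R K)).2 this

variable (K κ) in
lemma rank_map_algebraMap_le (A : Matrix m n R) :
    (A.map (algebraMap R κ)).rank ≤ (A.map (algebraMap R K)).rank := by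
  obtain ⟨e, g, hδ⟩ := A.exists_algebraMap_det_submatrix_ne_zero (κ := κ) rfl
  have hδK := det_map_algebraMap_ne_zero_of_algebraMap_det_ne_zero (K := K) hδ
  exact ((rank_of_det_ne_zero hδK).trans (Fintype.card_fin _)).ge.trans
    (rank_submatrix_le (A.map (algebraMap R K)) e g)

/-- If a matrix over `R` has the same rank over `K`, where `R` embeds, as over another field `κ`,
then it is von Neumann regular up to a scalar that is nonzero in `κ`. -/
lemma exists_mul_mul_eq_smul (A : Matrix m n R)
    (h : (A.map (algebraMap R K)).rank ≤ (A.map (algebraMap R κ)).rank) :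
    ∃ (S : Matrix n m R) (δ : R), algebraMap R κ δ ≠ 0 ∧ A * S * A = δ • A := by
  classical
  generalize hr : (A.map (algebraMap R κ)).rank = r at h
  obtain ⟨e, g, hδ⟩ := A.exists_algebraMap_det_submatrix_ne_zero hr
  let P := A.submatrix e g
  let U := A.submatrix id g
  let V := A.submatrix e id
  have hδK : (P.map (algebraMap R K)).det ≠ 0 :=
    det_map_algebraMap_ne_zero_of_algebraMap_det_ne_zero hδ
  have hU : r ≤ ((A.map (algebraMap R K)).submatrix id g).rank :=
    ((rank_of_det_ne_zero hδK).trans (Fintype.card_fin r)).ge.trans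
      (rank_submatrix_le ((A.map (algebraMap R K)).submatrix id g) e id)
  obtain ⟨Y, hY⟩ := (A.map (algebraMap R K)).exists_eq_submatrix_mul g (h.trans hU)
  have hV : V.map (algebraMap R K) = P.map (algebraMap R K) * Y :=
    congrArg (fun M ↦ M.submatrix e id) hY
  have key : U * P.adjugate * V = P.det • A := by
    apply Matrix.map_injective (FaithfulSMul.algebraMap_injective R K)
    have hsmul : (P.det • A).map (algebraMap R K) =
        (P.map (algebraMap R K)).det • A.map (algebraMap R K) := by
      ext i j
      simp [RingHom.map_det]
    change (U * P.adjugate * V).map (algebraMap R K) = (P.det • A).map (algebraMap R K)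
    rw [Matrix.map_mul, Matrix.map_mul, hV, ← RingHom.mapMatrix_apply (algebraMap R K) P.adjugate,
      RingHom.map_adjugate, RingHom.mapMatrix_apply, Matrix.mul_assoc,
      ← Matrix.mul_assoc _ _ Y, adjugate_mul, Matrix.smul_mul, Matrix.one_mul, Matrix.mul_smul,
      hsmul]
    exact congrArg _ hY.symm
  refine ⟨(1 : Matrix n n R).submatrix id g * P.adjugate * (1 : Matrix m m R).submatrix e id,
    P.det, hδ, ?_⟩
  have hAU : A * (1 : Matrix n n R).submatrix id g = U := by
    ext i j
    simp [U, Matrix.mul_apply, Matrix.one_apply]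
  have hAV : (1 : Matrix m m R).submatrix e id * A = V := by
    ext i j
    simp [V, Matrix.mul_apply, Matrix.one_apply]
  rw [← key, ← hAU, ← hAV]
  simp only [Matrix.mul_assoc]

end BaseChange

end Matrix

namespace LinearMap

open Module

variable {R M N : Type*} [CommRing R] [AddCommGroup M] [Module R M] [Module.Finite R M]
  [Module.Free R M] [AddCommGroup N] [Module R N] [Module.Finite R N] [Module.Free R N]

omit [Module.Finite R M] [Free R M] [Module.Finite R N] [Free R N] in
lemma finrank_range_baseChange_eq_rank_map {ι ι' F : Type*} [Fintype ι] [DecidableEq ι]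
    [Fintype ι'] [Field F] [Algebra R F] (b : Basis ι R M) (b' : Basis ι' R N) (f : M →ₗ[R] N) :
    finrank F (range (f.baseChange F)) = ((toMatrix b b' f).map (algebraMap R F)).rank := by
  rw [← toMatrix_baseChange, Matrix.rank_eq_finrank_range_toLin _
    (Algebra.TensorProduct.basis F b') (Algebra.TensorProduct.basis F b), Matrix.toLin_toMatrix]

lemma finrank_range_baseChange_le {K κ : Type*} [Field K] [Algebra R K]
    [FaithfulSMul R K] [Field κ] [Algebra R κ] (f : M →ₗ[R] N) :
    finrank κ (range (f.baseChange κ)) ≤ finrank K (range (f.baseChange K)) := by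
  have := (algebraMap R κ).domain_nontrivial
  rw [finrank_range_baseChange_eq_rank_map (Free.chooseBasis R M) (Free.chooseBasis R N),
    finrank_range_baseChange_eq_rank_map (Free.chooseBasis R M) (Free.chooseBasis R N)]
  exact Matrix.rank_map_algebraMap_le K κ _

/-- If a map of finite free modules has the same rank over `K`, where `R` embeds, as over another
field `κ`, then it is von Neumann regular up to a scalar that is nonzero in `κ`. -/
lemma exists_comp_comp_eq_smul {K κ : Type*} [Field K] [Algebra R K]
    [FaithfulSMul R K] [Field κ] [Algebra R κ] (f : M →ₗ[R] N)
    (h : finrank K (range (f.baseChange K)) ≤ finrank κ (range (f.baseChange κ))) :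
    ∃ (s : N →ₗ[R] M) (δ : R), algebraMap R κ δ ≠ 0 ∧ f ∘ₗ s ∘ₗ f = δ • f := by
  classical
  have := (algebraMap R κ).domain_nontrivial
  let b := Free.chooseBasis R M
  let b' := Free.chooseBasis R N
  rw [finrank_range_baseChange_eq_rank_map b b', finrank_range_baseChange_eq_rank_map b b'] at h
  obtain ⟨S, δ, hδ, hS⟩ := Matrix.exists_mul_mul_eq_smul _ h
  refine ⟨Matrix.toLin b' b S, δ, hδ, (toMatrix b b').injective ?_⟩
  rw [toMatrix_comp b b b', toMatrix_comp b b' b, toMatrix_toLin, map_smul, ← hS,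
    Matrix.mul_assoc]

end LinearMap

section Subquot

open LinearMap

variable {R κ M' M N : Type*} [CommRing R] [Field κ] [Algebra R κ] [AddCommGroup M'] [Module R M']
  [AddCommGroup M] [Module R M] [AddCommGroup N] [Module R N]

variable (κ) in
/-- The comparison map from the base change of a kernel to the kernel of the base change. -/
noncomputable def kerBaseChange (d : M →ₗ[R] N) : κ ⊗[R] ker d →ₗ[κ] ker (d.baseChange κ) :=
  ((ker d).subtype.baseChange κ).codRestrict _ fun x ↦ by
    have h : d ∘ₗ (ker d).subtype = 0 := by
      ext z
      exact z.2
    rw [mem_ker, ← comp_apply, ← baseChange_comp, h, baseChange_zero, LinearMap.zero_apply]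

lemma coe_kerBaseChange (d : M →ₗ[R] N) (x : κ ⊗[R] ker d) :
    (kerBaseChange κ d x : κ ⊗[R] M) = (ker d).subtype.baseChange κ x := rfl

lemma kerBaseChange_bijective {d : M →ₗ[R] N} {s : N →ₗ[R] M} {δ : R}
    (hδ : algebraMap R κ δ ≠ 0) (hs : d ∘ₗ s ∘ₗ d = δ • d) :
    Function.Bijective (kerBaseChange κ d) := by
  let e : M →ₗ[R] ker d := (δ • LinearMap.id - s ∘ₗ d).codRestrict _ fun x ↦ by
    have := LinearMap.congr_fun hs x
    simp only [comp_apply, LinearMap.smul_apply] at this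
    simp [this]
  have he : e ∘ₗ (ker d).subtype = δ • LinearMap.id := by
    ext z
    simp [e]
  have he' : (ker d).subtype ∘ₗ e = δ • LinearMap.id - s ∘ₗ d := rfl
  constructor
  · refine (injective_iff_map_eq_zero _).2 fun y hy ↦ ?_
    have h1 : e.baseChange κ (kerBaseChange κ d y : κ ⊗[R] M) = algebraMap R κ δ • y := by
      rw [coe_kerBaseChange, ← comp_apply, ← baseChange_comp, he]
      simp
    rw [hy, Submodule.coe_zero, map_zero] at h1
    exact (smul_eq_zero_iff_right hδ).1 h1.symm
  · intro x
    refine ⟨(algebraMap R κ δ)⁻¹ • e.baseChange κ x, Subtype.ext ?_⟩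
    have h1 : (kerBaseChange κ d (e.baseChange κ x) : κ ⊗[R] M) =
        algebraMap R κ δ • (x : κ ⊗[R] M) := by
      rw [coe_kerBaseChange, ← comp_apply, ← baseChange_comp, he', baseChange_sub, baseChange_comp]
      simp
    rw [map_smul, Submodule.coe_smul, h1, inv_smul_smul₀ hδ]

variable (κ) in
/-- The base-change map on the cohomology of `M' → M → N` at `M`. -/
noncomputable def subquotBaseChange (f : M' →ₗ[R] M) (d : M →ₗ[R] N) :
    κ ⊗[R] subquot (ker d) (range f) →ₗ[κ]
      subquot (ker (d.baseChange κ)) (range (f.baseChange κ)) :=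
  liftBaseChange κ <| Submodule.liftQ _
    ((((Submodule.mkQ _).comp (kerBaseChange κ d)).restrictScalars R).comp
      (TensorProduct.mk R κ (ker d) 1)) <| by
    rintro z ⟨y, hy⟩
    simp only [mem_ker, comp_apply, restrictScalars_apply, Submodule.mkQ_apply,
      Submodule.Quotient.mk_eq_zero, Submodule.mem_comap]
    refine ⟨1 ⊗ₜ y, ?_⟩
    simp [coe_kerBaseChange, hy]

lemma subquotBaseChange_tmul_mk (f : M' →ₗ[R] M) (d : M →ₗ[R] N) (l : κ) (z : ker d) :
    subquotBaseChange κ f d (l ⊗ₜ Submodule.Quotient.mk z) =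
      Submodule.Quotient.mk (kerBaseChange κ d (l ⊗ₜ z)) := by
  rw [subquotBaseChange, liftBaseChange_tmul]
  change l • Submodule.Quotient.mk (kerBaseChange κ d (1 ⊗ₜ z)) = _
  rw [← Submodule.Quotient.mk_smul, ← map_smul, TensorProduct.smul_tmul', smul_eq_mul, mul_one]

lemma subquotBaseChange_baseChange_mkQ (f : M' →ₗ[R] M) (d : M →ₗ[R] N) (x : κ ⊗[R] ker d) :
    subquotBaseChange κ f d
        ((Submodule.mkQ (Submodule.comap (ker d).subtype (range f))).baseChange κ x) =
      Submodule.Quotient.mk (kerBaseChange κ d x) := by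
  induction x with
  | zero => simp
  | tmul l z => exact subquotBaseChange_tmul_mk f d l z
  | add x y hx hy => rw [map_add, map_add, hx, hy, map_add, Submodule.Quotient.mk_add]

lemma subquotBaseChange_bijective {f : M' →ₗ[R] M} {d : M →ₗ[R] N} (hdf : d ∘ₗ f = 0)
    (h : Function.Bijective (kerBaseChange κ d)) :
    Function.Bijective (subquotBaseChange κ f d) := by
  set q := Submodule.mkQ (Submodule.comap (ker d).subtype (range f))
  have hq : Function.Surjective (q.baseChange κ) :=
    lTensor_surjective κ (Submodule.mkQ_surjective _)
  constructor
  · refine (injective_iff_map_eq_zero _).2 fun x hx ↦ ?_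
    obtain ⟨y, rfl⟩ := hq x
    rw [subquotBaseChange_baseChange_mkQ, Submodule.Quotient.mk_eq_zero] at hx
    obtain ⟨u, hu⟩ := hx
    let f' : M' →ₗ[R] ker d := f.codRestrict _ fun x ↦ LinearMap.congr_fun hdf x
    have hy : f'.baseChange κ u = y := by
      apply h.1
      apply Subtype.ext
      rw [coe_kerBaseChange, ← comp_apply, ← baseChange_comp]
      exact hu
    have hqf : q ∘ₗ f' = 0 := by
      ext x
      exact (Submodule.Quotient.mk_eq_zero _).2 ⟨x, rfl⟩
    rw [← hy, ← comp_apply, ← baseChange_comp, hqf]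
    simp
  · intro x
    obtain ⟨w, rfl⟩ := Submodule.Quotient.mk_surjective _ x
    obtain ⟨y, rfl⟩ := h.2 w
    exact ⟨_, subquotBaseChange_baseChange_mkQ f d y⟩

/-- If `d` is von Neumann regular up to a scalar that is nonzero in `κ`, then the natural base-change
map on the cohomology of `M' → M → N` at `M` is bijective. -/
lemma exists_subquot_baseChange_bijective {f : M' →ₗ[R] M} {d : M →ₗ[R] N} (hdf : d ∘ₗ f = 0)
    {s : N →ₗ[R] M} {δ : R} (hδ : algebraMap R κ δ ≠ 0) (hs : d ∘ₗ s ∘ₗ d = δ • d) :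
    ∃ Φ : (κ ⊗[R] subquot (ker d) (range f)) →ₗ[κ]
        subquot (ker (d.baseChange κ)) (range (f.baseChange κ)),
      (∀ (z : ker d) (l : κ), ∃ w : ker (d.baseChange κ), (w : κ ⊗[R] M) = l ⊗ₜ[R] (z : M)) ∧
      (∀ (z : ker d) (l : κ) (w : ker (d.baseChange κ)), (w : κ ⊗[R] M) = l ⊗ₜ[R] (z : M) →
        Φ (l ⊗ₜ[R] Submodule.Quotient.mk z) = Submodule.Quotient.mk w) ∧
      Function.Bijective Φ := by
  refine ⟨subquotBaseChange κ f d, fun z l ↦ ⟨kerBaseChange κ d (l ⊗ₜ z), rfl⟩,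
    fun z l w hw ↦ ?_, subquotBaseChange_bijective hdf (kerBaseChange_bijective hδ hs)⟩
  rw [show w = kerBaseChange κ d (l ⊗ₜ z) from Subtype.ext hw]
  exact subquotBaseChange_tmul_mk f d l z

end Subquot

lemma finrank_subquot_add_finrank_range {F V' V W : Type*} [Field F] [AddCommGroup V']
    [Module F V'] [AddCommGroup V] [Module F V] [AddCommGroup W] [Module F W]
    [FiniteDimensional F V]
    {f : V' →ₗ[F] V} {d : V →ₗ[F] W} (h : LinearMap.range f ≤ LinearMap.ker d) :
    Module.finrank F (subquot (LinearMap.ker d) (LinearMap.range f)) +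
      Module.finrank F (LinearMap.range f) + Module.finrank F (LinearMap.range d) =
        Module.finrank F V := by
  rw [← (Submodule.comapSubtypeEquivOfLe h).finrank_eq, Submodule.finrank_quotient_add_finrank,
    add_comm, LinearMap.finrank_range_add_finrank_ker]

lemma LinearMap.range_baseChange_le_ker {R F M' M N : Type*} [CommRing R] [CommRing F]
    [Algebra R F] [AddCommGroup M'] [Module R M'] [AddCommGroup M] [Module R M]
    [AddCommGroup N] [Module R N] {f : M' →ₗ[R] M} {d : M →ₗ[R] N} (h : d ∘ₗ f = 0) :
    range (f.baseChange F) ≤ ker (d.baseChange F) := by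
  rw [range_le_ker_iff, ← baseChange_comp, h, baseChange_zero]

/-- In a complex `C⁰ → C¹ → C² → C³` of finite free modules, if the dimension of `H¹` is the same
over `K`, where the base ring embeds, as over `κ`, and `H²` vanishes over `κ`, then the rank of the
first differential is the same over `K` as over `κ`. -/
lemma finrank_range_baseChange_le_of_finrank_subquot_eq {R K κ C₀ C₁ C₂ C₃ : Type*} [CommRing R]
    [Field K] [Algebra R K] [FaithfulSMul R K] [Field κ] [Algebra R κ]
    [AddCommGroup C₀] [Module R C₀]
    [AddCommGroup C₁] [Module R C₁] [Module.Finite R C₁] [Module.Free R C₁]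
    [AddCommGroup C₂] [Module R C₂] [Module.Finite R C₂] [Module.Free R C₂]
    [AddCommGroup C₃] [Module R C₃] [Module.Finite R C₃] [Module.Free R C₃]
    {d₀ : C₀ →ₗ[R] C₁} {d₁ : C₁ →ₗ[R] C₂} {d₂ : C₂ →ₗ[R] C₃}
    (h₁₀ : d₁ ∘ₗ d₀ = 0) (h₂₁ : d₂ ∘ₗ d₁ = 0)
    (hexact : LinearMap.ker (d₂.baseChange κ) ≤ LinearMap.range (d₁.baseChange κ))
    (hfinrank : Module.finrank K (subquot (LinearMap.ker (d₁.baseChange K))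
        (LinearMap.range (d₀.baseChange K))) =
      Module.finrank κ (subquot (LinearMap.ker (d₁.baseChange κ))
        (LinearMap.range (d₀.baseChange κ)))) :
    Module.finrank K (LinearMap.range (d₀.baseChange K)) ≤
      Module.finrank κ (LinearMap.range (d₀.baseChange κ)) := by
  have := (algebraMap R κ).domain_nontrivial
  have hK := finrank_subquot_add_finrank_range (LinearMap.range_baseChange_le_ker (F := K) h₁₀)
  have hκ := finrank_subquot_add_finrank_range (LinearMap.range_baseChange_le_ker (F := κ) h₁₀)
  have hK₂ := (d₂.baseChange K).finrank_range_add_finrank_ker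
  have hκ₂ := (d₂.baseChange κ).finrank_range_add_finrank_ker
  have hle := Submodule.finrank_mono hexact
  have hleK := Submodule.finrank_mono (LinearMap.range_baseChange_le_ker (F := K) h₂₁)
  have h₁ := d₁.finrank_range_baseChange_le (K := K) (κ := κ)
  have h₂ := d₂.finrank_range_baseChange_le (K := K) (κ := κ)
  rw [Module.finrank_baseChange] at hK hκ hK₂ hκ₂
  omega

set_option maxHeartbeats 1000000 in
set_option synthInstance.maxHeartbeats 1000000 in
/-- Let `R` be a Noetherian integral domain, `C` a bounded cochain complex of
finitely generated free `R`-modules (differentials `d i : C i → C (i+1)`, `d ∘ d = 0`), and `p`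
a prime ideal of `R` with residue field `κ(p)` (the fraction field of `R ⧸ p`).  Assume:
(a) `H^i(C ⊗ κ(p)) = 0` for all `i ≥ 2`; and
(b) there is a dense open `U ⊆ Spec R` such that for all `q ∈ U`,
`dim_{κ(q)} H^1(C ⊗ κ(q)) = dim_{κ(p)} H^1(C ⊗ κ(p))`.
Then the natural base-change map `H^0(C) ⊗_R κ(p) → H^0(C ⊗ κ(p))`, determined by
`λ ⊗ [z] ↦ [λ ⊗ z]`, is an isomorphism of `κ(p)`-vector spaces.
(Cohomology at spot `j` is `ker (d j) / im (d (j - 1))`.) -/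
theorem stmt9 (R : Type*) [CommRing R] [IsDomain R] [IsNoetherianRing R]
    (C : ℤ → Type*) [∀ i, AddCommGroup (C i)] [∀ i, Module R (C i)]
    [∀ i, Module.Finite R (C i)] [∀ i, Module.Free R (C i)]
    (d : ∀ i : ℤ, C i →ₗ[R] C (i + 1))
    (hdd : ∀ i : ℤ, (d (i + 1)).comp (d i) = 0)
    (hbdd : ∃ a b : ℤ, ∀ i : ℤ, (i < a ∨ b < i) → Subsingleton (C i))
    (p : Ideal R) [p.IsPrime]
    (κ : Type*) [Field κ] [Algebra R κ] [Algebra (R ⧸ p) κ]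
    [IsScalarTower R (R ⧸ p) κ] [IsFractionRing (R ⧸ p) κ]
    (ha : ∀ i : ℤ, 1 ≤ i →
      LinearMap.ker (LinearMap.baseChange κ (d (i + 1))) ≤
        LinearMap.range (LinearMap.baseChange κ (d i)))
    (hb : ∃ U : Set (PrimeSpectrum R), IsOpen U ∧ Dense U ∧ ∀ q ∈ U,
      letI : Algebra R (FractionRing (R ⧸ q.asIdeal)) :=
        ((algebraMap (R ⧸ q.asIdeal) (FractionRing (R ⧸ q.asIdeal))).comp
          (Ideal.Quotient.mk q.asIdeal)).toAlgebra
      Module.finrank (FractionRing (R ⧸ q.asIdeal))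
          (H1BaseChange d (FractionRing (R ⧸ q.asIdeal)))
        = Module.finrank κ (H1BaseChange d κ)) :
    ∃ Φ : (κ ⊗[R] subquot (LinearMap.ker (d 0)) (LinearMap.range (d (-1)))) →ₗ[κ]
        subquot (LinearMap.ker (LinearMap.baseChange κ (d 0)))
          (LinearMap.range (LinearMap.baseChange κ (d (-1)))),
      (∀ (z : LinearMap.ker (d 0)) (lam : κ),
          ∃ w : LinearMap.ker (LinearMap.baseChange κ (d 0)),
            (w : κ ⊗[R] C 0) = lam ⊗ₜ[R] (z : C 0)) ∧
      (∀ (z : LinearMap.ker (d 0)) (lam : κ)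
          (w : LinearMap.ker (LinearMap.baseChange κ (d 0))),
          (w : κ ⊗[R] C 0) = lam ⊗ₜ[R] (z : C 0) →
            Φ (lam ⊗ₜ[R] Submodule.Quotient.mk z) = Submodule.Quotient.mk w) ∧
      Function.Bijective Φ := by
  obtain ⟨U, hUo, hUd, hU⟩ := hb
  have hbot : (⊥ : PrimeSpectrum R) ∈ U := by
    obtain ⟨q, hq⟩ := hUd.nonempty
    exact (PrimeSpectrum.le_iff_specializes ⊥ q |>.1 bot_le).mem_open hUo hq
  let q : PrimeSpectrum R := ⊥
  let A : Algebra R (FractionRing (R ⧸ q.asIdeal)) :=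
    ((algebraMap (R ⧸ q.asIdeal) (FractionRing (R ⧸ q.asIdeal))).comp
      (Ideal.Quotient.mk q.asIdeal)).toAlgebra
  have : @FaithfulSMul R (FractionRing (R ⧸ q.asIdeal)) A.toSMul := by
    refine (@faithfulSMul_iff_algebraMap_injective R _ _ _ A).2 ?_
    exact (IsFractionRing.injective (R ⧸ q.asIdeal) (FractionRing (R ⧸ q.asIdeal))).comp
      ((injective_iff_map_eq_zero (Ideal.Quotient.mk q.asIdeal)).2 fun a ha ↦
        Ideal.Quotient.eq_zero_iff_mem.1 ha)
  have hrank := finrank_range_baseChange_le_of_finrank_subquot_eq (d₀ := d 0) (d₁ := d 1)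
    (K := FractionRing (R ⧸ q.asIdeal)) (hdd 0) (hdd 1) (ha 1 le_rfl) (hU ⊥ hbot)
  obtain ⟨s, δ, hδ, hs⟩ := (d 0).exists_comp_comp_eq_smul hrank
  obtain ⟨Φ, h₁, h₂, h₃⟩ := exists_subquot_baseChange_bijective
    (show d 0 ∘ₗ (show C (-1) →ₗ[R] C 0 from d (-1)) = 0 from hdd (-1)) hδ hs
  exact ⟨Φ, h₁, h₂, h₃⟩
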